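/- arXiv:2602.04124 — 3 statements merged into one kernel-verified Lean document; each statement's English description precedes it below -/
import Mathlib

section
/- Let Θ be a measurable space equipped with a measure ξ, let n ≥ 1, and let g_1, …, g_n : Θ → ℝ be measurable functions (the sensitive weighted log-likelihood contributions of the n records). Fix an index j ∈ {1,…,n} and let Δ ≥ 0 satisfy |g_j(θ)| ≤ Δ for all θ ∈ Θ. Define L(θ) = Σ_{i=1}^{n} g_i(θ) and L'(θ) = Σ_{i≠j} g_i(θ), and assume 0 < ∫_Θ exp(L) dξ < ∞ and 0 < ∫_Θ exp(L') dξ < ∞. Then for every measurable set B ⊆ Θ, (∫_B exp(L) dξ)/(∫_Θ exp(L) dξ) ≤ exp(2Δ) · (∫_B exp(L') dξ)/(∫_Θ exp(L') dξ). -/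
open MeasureTheory Real

/-- If `u ≤ Δ + v` pointwise, then `∫ exp u ≤ exp Δ * ∫ exp v`. -/
theorem integral_exp_le_exp_mul_integral_exp
    {Θ : Type*} [MeasurableSpace Θ] {μ : Measure Θ} {u v : Θ → ℝ} {Δ : ℝ}
    (hu : Integrable (fun θ => exp (u θ)) μ) (hv : Integrable (fun θ => exp (v θ)) μ)
    (huv : ∀ θ, u θ ≤ Δ + v θ) :
    ∫ θ, exp (u θ) ∂μ ≤ exp Δ * ∫ θ, exp (v θ) ∂μ := by
  rw [← integral_const_mul]
  refine integral_mono hu (hv.const_mul _) fun θ => ?_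
  rw [← exp_add]
  exact exp_le_exp.2 (huv θ)

/-- General range-restricted privacy theorem: if the sensitive weighted
log-likelihood contribution `g j` of the differing record `j` is uniformly
bounded by `Δ`, then the pseudo posterior mechanism for the full database
(summing all `n` contributions) and for the adjacent database (with record `j`
deleted) satisfy an `exp (2Δ)` likelihood-ratio bound. -/
theorem range_restricted_privacy_general
    {Θ : Type*} [MeasurableSpace Θ] (ξ : Measure Θ)
    (n : ℕ) (hn : 1 ≤ n) (g : Fin n → Θ → ℝ) (hg : ∀ i, Measurable (g i))
    (j : Fin n) (Δ : ℝ) (hΔ : 0 ≤ Δ) (hbound : ∀ θ : Θ, |g j θ| ≤ Δ)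
    (L L' : Θ → ℝ)
    (hLdef : ∀ θ, L θ = ∑ i, g i θ)
    (hL'def : ∀ θ, L' θ = ∑ i ∈ Finset.univ.erase j, g i θ)
    (hint : Integrable (fun θ => exp (L θ)) ξ)
    (hint' : Integrable (fun θ => exp (L' θ)) ξ)
    (hpos : 0 < ∫ θ, exp (L θ) ∂ξ)
    (hpos' : 0 < ∫ θ, exp (L' θ) ∂ξ) :
    ∀ B : Set Θ, MeasurableSet B →
      (∫ θ in B, exp (L θ) ∂ξ) / (∫ θ, exp (L θ) ∂ξ) ≤
        exp (2 * Δ) * ((∫ θ in B, exp (L' θ) ∂ξ) / (∫ θ, exp (L' θ) ∂ξ)) := by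
  intro B _
  have hL (θ : Θ) : L θ = g j θ + L' θ := by
    rw [hLdef, hL'def, Finset.add_sum_erase _ (fun i => g i θ) (Finset.mem_univ j)]
  have hnum := integral_exp_le_exp_mul_integral_exp (μ := ξ.restrict B) (Δ := Δ)
    hint.integrableOn hint'.integrableOn fun θ => by
      linarith [hL θ, (abs_le.1 (hbound θ)).2]
  have hden := integral_exp_le_exp_mul_integral_exp (Δ := Δ) hint' hint fun θ => by
    linarith [hL θ, (abs_le.1 (hbound θ)).1]
  have hnonneg : 0 ≤ ∫ θ in B, exp (L' θ) ∂ξ := integral_nonneg fun θ => (exp_pos _).le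
  rw [← mul_div_assoc, div_le_div_iff₀ hpos hpos']
  calc (∫ θ in B, exp (L θ) ∂ξ) * ∫ θ, exp (L' θ) ∂ξ
      ≤ (exp Δ * ∫ θ in B, exp (L' θ) ∂ξ) * (exp Δ * ∫ θ, exp (L θ) ∂ξ) := by gcongr
    _ = exp (2 * Δ) * (∫ θ in B, exp (L' θ) ∂ξ) * ∫ θ, exp (L θ) ∂ξ := by
      rw [two_mul, exp_add]
      ring
end

section
/- (Range-averaged privacy under the posterior mechanism.) Let Θ be a measurable space equipped with a prior measure ξ, let n ≥ 1, and for each record i ∈ {1,…,n} let p_i : Θ → ℝ be measurable with p_i(θ) > 0 for all θ (the likelihood value p(x_i | θ)), and let λ_i ∈ [0,1] be given. Define L(θ) = Σ_{i=1}^{n} (1−λ_i)·log p_i(θ), and for a fixed index j define L'(θ) = Σ_{i≠j} (1−λ_i)·log p_i(θ). Let Δ ≥ 0 satisfy |(1−λ_i)·log p_i(θ)| ≤ Δ for all θ ∈ Θ and all i (so Δ bounds the sensitivity Δ_{λ,x}). If 0 < ∫_Θ exp(L) dξ < ∞ and 0 < ∫_Θ exp(L') dξ < ∞, then for every measurable set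 B ⊆ Θ, (∫_B exp(L) dξ)/(∫_Θ exp(L) dξ) ≤ exp(2Δ) · (∫_B exp(L') dξ)/(∫_Θ exp(L') dξ). -/
open MeasureTheory Real

/-- If `f ≤ g + c` pointwise, then `∫ exp f ≤ exp c * ∫ exp g`. -/
theorem integral_exp_le_exp_mul_integral_exp_s4 {α : Type*} [MeasurableSpace α] {μ : Measure α}
    {f g : α → ℝ} {c : ℝ} (hf : Integrable (fun x => exp (f x)) μ)
    (hg : Integrable (fun x => exp (g x)) μ) (h : ∀ x, f x ≤ g x + c) :
    ∫ x, exp (f x) ∂μ ≤ exp c * ∫ x, exp (g x) ∂μ := by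
  rw [← integral_const_mul]
  refine integral_mono hf (hg.const_mul _) fun x => ?_
  rw [← exp_add, add_comm c]
  exact exp_le_exp.mpr (h x)

/-- Gibbs measures whose log-densities differ by at most `c` assign to every set masses within a
factor `exp (2 * c)`. -/
theorem setIntegral_exp_div_le_exp_mul {α : Type*} [MeasurableSpace α] {μ : Measure α}
    {f g : α → ℝ} {c : ℝ} (hf : Integrable (fun x => exp (f x)) μ)
    (hg : Integrable (fun x => exp (g x)) μ) (hf_pos : 0 < ∫ x, exp (f x) ∂μ)
    (hg_pos : 0 < ∫ x, exp (g x) ∂μ) (h : ∀ x, |f x - g x| ≤ c) (B : Set α) :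
    (∫ x in B, exp (f x) ∂μ) / (∫ x, exp (f x) ∂μ) ≤
      exp (2 * c) * ((∫ x in B, exp (g x) ∂μ) / (∫ x, exp (g x) ∂μ)) := by
  have num_le := integral_exp_le_exp_mul_integral_exp_s4 (hf.restrict (s := B)) hg.restrict
    (c := c) fun x => by linarith [(abs_le.mp (h x)).2]
  have den_le := integral_exp_le_exp_mul_integral_exp_s4 hg hf
    (c := c) fun x => by linarith [(abs_le.mp (h x)).1]
  have hB : 0 ≤ ∫ x in B, exp (g x) ∂μ := integral_nonneg fun x => (exp_pos _).le
  rw [← mul_div_assoc, div_le_div_iff₀ hf_pos hg_pos, two_mul, exp_add]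
  calc (∫ x in B, exp (f x) ∂μ) * ∫ x, exp (g x) ∂μ
      ≤ (exp c * ∫ x in B, exp (g x) ∂μ) * (exp c * ∫ x, exp (f x) ∂μ) := by gcongr
    _ = _ := by ring

/-- Range-averaged privacy under the posterior mechanism: with pseudo
log-likelihood `L θ = ∑ i, (1 - λ i) * log (p i θ)` and adjacent pseudo
log-likelihood `L'` omitting record `j`, a uniform bound `Δ` on each sensitive
contribution `|(1 - λ i) * log (p i θ)|` yields a local privacy guarantee `2Δ`
for the range-averaged posterior mechanism. -/
theorem range_averaged_privacy_posterior
    {Θ : Type*} [MeasurableSpace Θ] (ξ : Measure Θ)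
    (n : ℕ) (hn : 1 ≤ n) (p : Fin n → Θ → ℝ)
    (hpmeas : ∀ i, Measurable (p i)) (hppos : ∀ i θ, 0 < p i θ)
    (lam : Fin n → ℝ) (hlam : ∀ i, lam i ∈ Set.Icc (0 : ℝ) 1)
    (j : Fin n) (Δ : ℝ) (hΔ : 0 ≤ Δ)
    (hsens : ∀ θ : Θ, ∀ i, |(1 - lam i) * Real.log (p i θ)| ≤ Δ)
    (L L' : Θ → ℝ)
    (hLdef : ∀ θ, L θ = ∑ i, (1 - lam i) * Real.log (p i θ))
    (hL'def : ∀ θ, L' θ = ∑ i ∈ Finset.univ.erase j, (1 - lam i) * Real.log (p i θ))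
    (hint : Integrable (fun θ => exp (L θ)) ξ)
    (hint' : Integrable (fun θ => exp (L' θ)) ξ)
    (hpos : 0 < ∫ θ, exp (L θ) ∂ξ)
    (hpos' : 0 < ∫ θ, exp (L' θ) ∂ξ) :
    ∀ B : Set Θ, MeasurableSet B →
      (∫ θ in B, exp (L θ) ∂ξ) / (∫ θ, exp (L θ) ∂ξ) ≤
        exp (2 * Δ) * ((∫ θ in B, exp (L' θ) ∂ξ) / (∫ θ, exp (L' θ) ∂ξ)) := by
  intro B _
  refine setIntegral_exp_div_le_exp_mul hint hint' hpos hpos' (fun θ => ?_) B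
  rw [hLdef, hL'def, ← Finset.add_sum_erase _ _ (Finset.mem_univ j), add_sub_cancel_right]
  exact hsens θ j
end

section
/- (Range-truncated privacy under the posterior mechanism.) Let Θ be a measurable space with prior measure ξ, let X be a measurable space with a σ-finite measure μ, and let κ be a Markov kernel from Θ to X such that for each θ, κ(θ) = μ.withDensity(p(θ,·)) for a jointly measurable density p : Θ × X → ℝ≥0. Let x_1,…,x_n ∈ X with p(θ, x_i) > 0 for all θ and i, and let R_1,…,R_n ⊆ X be measurable sets with x_i ∈ R_i and κ(θ)(R_i) > 0 for all θ and i. Define L(θ) = Σ_{i=1}^{n} (log p(θ, x_i) − log κ(θ)(R_i)), and for a fixed index j define L'(θ) = Σ_{i≠j} (log p(θ, x_i) − log κ(θ)(R_i)). Let Δ ≥ 0 satisfy |log p(θ, x_i) − log κ(θ)(R_i)| ≤ Δ for all θ and i (so Δ bounds the sensitivity Δ_{I,x}). If 0 < ∫_Θ exp(L) dξ < ∞ and 0 < ∫_Θ exp(L') dξ < ∞, then for every measurable set B ⊆ Θ, (∫_B exp(L) dξ)/(∫_Θ exp(L) dξ) ≤ exp(2Δ) · (∫_B exp(L') dξ)/(∫_Θ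 exp(L') dξ). -/
open MeasureTheory ProbabilityTheory Real

/-- If the log-densities `f` and `g` differ by at most `Δ` everywhere, then the normalized
exponential weights of any set under `f` and `g` differ by a factor of at most
`exp (2 * Δ)`. -/
theorem setIntegral_exp_div_integral_exp_le {Θ : Type*} [MeasurableSpace Θ] {ξ : Measure Θ}
    {f g : Θ → ℝ} {Δ : ℝ} (hfg : ∀ θ, |f θ - g θ| ≤ Δ)
    (hf : Integrable (fun θ => exp (f θ)) ξ) (hg : Integrable (fun θ => exp (g θ)) ξ)
    (hf_pos : 0 < ∫ θ, exp (f θ) ∂ξ) (hg_pos : 0 < ∫ θ, exp (g θ) ∂ξ) (B : Set Θ) :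
    (∫ θ in B, exp (f θ) ∂ξ) / (∫ θ, exp (f θ) ∂ξ) ≤
      exp (2 * Δ) * ((∫ θ in B, exp (g θ) ∂ξ) / (∫ θ, exp (g θ) ∂ξ)) := by
  have h_num : ∫ θ in B, exp (f θ) ∂ξ ≤ exp Δ * ∫ θ in B, exp (g θ) ∂ξ := by
    rw [← integral_const_mul]
    refine integral_mono hf.integrableOn (hg.integrableOn.const_mul _) fun θ => ?_
    rw [← exp_add]
    exact exp_le_exp.mpr (by linarith [(abs_le.mp (hfg θ)).2])
  have h_den : ∫ θ, exp (g θ) ∂ξ ≤ exp Δ * ∫ θ, exp (f θ) ∂ξ := by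
    rw [← integral_const_mul]
    refine integral_mono hg (hf.const_mul _) fun θ => ?_
    rw [← exp_add]
    exact exp_le_exp.mpr (by linarith [(abs_le.mp (hfg θ)).1])
  have h_nonneg : 0 ≤ ∫ θ in B, exp (g θ) ∂ξ := integral_nonneg fun θ => (exp_pos _).le
  rw [← mul_div_assoc, div_le_div_iff₀ hf_pos hg_pos, two_mul, exp_add]
  calc (∫ θ in B, exp (f θ) ∂ξ) * ∫ θ, exp (g θ) ∂ξ
      ≤ (exp Δ * ∫ θ in B, exp (g θ) ∂ξ) * (exp Δ * ∫ θ, exp (f θ) ∂ξ) :=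
        mul_le_mul h_num h_den hg_pos.le (mul_nonneg (exp_pos _).le h_nonneg)
    _ = exp Δ * exp Δ * (∫ θ in B, exp (g θ) ∂ξ) * ∫ θ, exp (f θ) ∂ξ := by ring

/-- Range-truncated privacy under the posterior mechanism: with truncated
log-likelihood `L θ = ∑ i, (log p(θ, x i) - log κ(θ)(R i))` and adjacent
log-likelihood `L'` omitting record `j`, a uniform bound `Δ` on each truncated
contribution yields a local privacy guarantee `2Δ` for the range-truncated
posterior mechanism. -/
theorem range_truncated_privacy_posterior
    {Θ X : Type*} [MeasurableSpace Θ] [MeasurableSpace X]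
    (ξ : Measure Θ) (μ : Measure X) [SigmaFinite μ]
    (κ : Kernel Θ X) [IsMarkovKernel κ]
    (p : Θ → X → NNReal) (hp : Measurable (Function.uncurry p))
    (hκ : ∀ θ : Θ, κ θ = μ.withDensity (fun x => (p θ x : ENNReal)))
    (n : ℕ) (hn : 1 ≤ n) (x : Fin n → X)
    (hxpos : ∀ θ : Θ, ∀ i, 0 < p θ (x i))
    (R : Fin n → Set X) (hRmeas : ∀ i, MeasurableSet (R i))
    (hxR : ∀ i, x i ∈ R i) (hRpos : ∀ θ : Θ, ∀ i, 0 < κ θ (R i))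
    (j : Fin n) (Δ : ℝ) (hΔ : 0 ≤ Δ)
    (hsens : ∀ θ : Θ, ∀ i,
      |Real.log (p θ (x i)) - Real.log ((κ θ (R i)).toReal)| ≤ Δ)
    (L L' : Θ → ℝ)
    (hLdef : ∀ θ, L θ =
      ∑ i, (Real.log (p θ (x i)) - Real.log ((κ θ (R i)).toReal)))
    (hL'def : ∀ θ, L' θ =
      ∑ i ∈ Finset.univ.erase j,
        (Real.log (p θ (x i)) - Real.log ((κ θ (R i)).toReal)))
    (hint : Integrable (fun θ => exp (L θ)) ξ)
    (hint' : Integrable (fun θ => exp (L' θ)) ξ)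
    (hpos : 0 < ∫ θ, exp (L θ) ∂ξ)
    (hpos' : 0 < ∫ θ, exp (L' θ) ∂ξ) :
    ∀ B : Set Θ, MeasurableSet B →
      (∫ θ in B, exp (L θ) ∂ξ) / (∫ θ, exp (L θ) ∂ξ) ≤
        exp (2 * Δ) * ((∫ θ in B, exp (L' θ) ∂ξ) / (∫ θ, exp (L' θ) ∂ξ)) := by
  intro B _
  refine setIntegral_exp_div_integral_exp_le (fun θ => ?_) hint hint' hpos hpos' B
  rw [hLdef, hL'def, ← Finset.add_sum_erase _ _ (Finset.mem_univ j), add_sub_cancel_right]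
  exact hsens θ j
end
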